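/- arXiv:1602.08340 — 3 statements merged into one kernel-verified Lean document; each statement's English description precedes it below -/
import Mathlib

section
/- Let k ≥ 2 be an integer and let α > 1 be a real number. Let g : A_k^ℕ → ℝ be continuous and positive, let h : A_k^ℕ → ℝ be continuous and vanish identically on Σ_{s_k}, and define V(x) = (g(x) + h(x))/δ_{s_k}(x)^α for δ_{s_k}(x) < ∞ and V(x) = 0 on Σ_{s_k}; assume V ≥ 0. Then for every x ∈ A_k^ℕ \ Σ_{s_k}, (R^n V)(x) → 0 as n → ∞. -/
/-- The `k`-bonacci substitution on letters: `a ↦ 0(a+1)` if `a ≠ k-1`, and `k-1 ↦ 0`. -/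
def sLetter {k : ℕ} (a : Fin k) : List (Fin k) :=
  if h : (a : ℕ) + 1 < k then
    [⟨0, Nat.lt_of_le_of_lt (Nat.zero_le _) a.isLt⟩, ⟨(a : ℕ) + 1, h⟩]
  else
    [⟨0, Nat.lt_of_le_of_lt (Nat.zero_le _) a.isLt⟩]

/-- Extension of the substitution to finite words by concatenation. -/
def sWord {k : ℕ} (w : List (Fin k)) : List (Fin k) := w.flatMap sLetter

/-- The prefix of length `n` of a right-infinite sequence. -/
def pref {k : ℕ} (x : ℕ → Fin k) (n : ℕ) : List (Fin k) :=
  (List.range n).map x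

/-- Extension of the substitution to right-infinite sequences, by concatenating the
images of the letters: since each letter has a nonempty image, the `m`-th letter of the
image is the `m`-th letter of the image of the prefix of length `m+1`. -/
def sSeq {k : ℕ} (x : ℕ → Fin k) : ℕ → Fin k :=
  fun m => (sWord (pref x (m + 1))).getD m (x 0)

/-- The left shift on sequences. -/
def shift {k : ℕ} (x : ℕ → Fin k) : ℕ → Fin k := fun n => x (n + 1)

/-- The language of the substitution: finite words occurring as a subword of some `s^m(a)`. -/
def Lang {k : ℕ} (w : List (Fin k)) : Prop :=
  ∃ (a : Fin k) (m : ℕ), w <:+: sWord^[m] [a]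

/-- `delta x = sup {n : prefix of x of length n is in the language}`, valued in `ℕ∞`. -/
noncomputable def delta {k : ℕ} (x : ℕ → Fin k) : ℕ∞ :=
  sSup {N : ℕ∞ | ∃ n : ℕ, N = (n : ℕ∞) ∧ Lang (pref x n)}

/-- The subshift associated to the substitution: sequences all of whose subwords
lie in the language. -/
def Attr (k : ℕ) : Set (ℕ → Fin k) :=
  {x | ∀ i n, Lang ((List.range n).map (fun j => x (i + j)))}

/-- The renormalization operator. -/
noncomputable def Renorm {k : ℕ} (V : (ℕ → Fin k) → ℝ) : (ℕ → Fin k) → ℝ :=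
  fun x => ∑ j ∈ Finset.range (sLetter (x 0)).length, V (shift^[j] (sSeq x))

/-- `vcoef k lam l = lam^{-(k-1-l)} * ∑_{j=0}^{k-1-l} lam^j`. -/
noncomputable def vcoef (k : ℕ) (lam : ℝ) (l : ℕ) : ℝ :=
  (∑ j ∈ Finset.range (k - l), lam ^ j) / lam ^ (k - 1 - l)

/-- The fixed point of the renormalization operator. -/
noncomputable def Ufix (k : ℕ) (lam : ℝ) (x : ℕ → Fin k) : ℝ :=
  if delta x = ⊤ then 0
  else Real.log (1 + vcoef k lam (x 0) /
    (lam / (lam - 1)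
      + (∑ l : Fin k, vcoef k lam (l : ℕ) * ((pref x (delta x).toNat).count l : ℝ))
      - vcoef k lam (x 0)))

/-- The word `s^n(0) · s^{n-1}(0) ⋯ s(0) · 0`. -/
def bword {k : ℕ} (z : Fin k) (n : ℕ) : List (Fin k) :=
  ((List.range (n + 1)).map (fun i => sWord^[n - i] [z])).flatten

/-- The word `s^{n-1}(0) · s^{n-2}(0) ⋯ s(0) · 0`. -/
def bsuffix {k : ℕ} (z : Fin k) (n : ℕ) : List (Fin k) :=
  ((List.range n).map (fun i => sWord^[n - 1 - i] [z])).flatten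

section Words

variable {k : ℕ}

lemma sWord_append (u v : List (Fin k)) : sWord (u ++ v) = sWord u ++ sWord v := by
  simp [sWord]

lemma sWord_iterate_append (n : ℕ) (u v : List (Fin k)) :
    sWord^[n] (u ++ v) = sWord^[n] u ++ sWord^[n] v := by
  induction n generalizing u v with
  | zero => rfl
  | succ n ih => simp only [Function.iterate_succ_apply, sWord_append, ih]

lemma sWord_singleton (a : Fin k) : sWord [a] = sLetter a := by
  simp [sWord]

lemma sLetter_of_lt {a : Fin k} (ha : (a : ℕ) + 1 < k) :
    sLetter a = [⟨0, a.pos⟩, ⟨(a : ℕ) + 1, ha⟩] := by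
  simp [sLetter, ha]

lemma sLetter_of_not_lt {a : Fin k} (ha : ¬ (a : ℕ) + 1 < k) :
    sLetter a = [⟨0, a.pos⟩] := by
  simp [sLetter, ha]

lemma exists_sLetter_eq_cons (a : Fin k) :
    ∃ t, sLetter a = ⟨0, a.pos⟩ :: t := by
  by_cases ha : (a : ℕ) + 1 < k
  · exact ⟨_, sLetter_of_lt ha⟩
  · exact ⟨_, sLetter_of_not_lt ha⟩

lemma length_le_length_sWord (w : List (Fin k)) : w.length ≤ (sWord w).length := by
  induction w with
  | nil => simp
  | cons a w ih =>
    obtain ⟨t, ht⟩ := exists_sLetter_eq_cons a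
    have : sWord (a :: w) = sLetter a ++ sWord w := by simp [sWord]
    rw [this, ht]
    simp only [List.length_cons, List.length_append]
    omega

lemma length_le_length_sWord_iterate (n : ℕ) (w : List (Fin k)) :
    w.length ≤ (sWord^[n] w).length := by
  induction n generalizing w with
  | zero => rfl
  | succ n ih => exact (length_le_length_sWord w).trans (ih _)

lemma sWord_iterate_succ_of_lt (n : ℕ) {a : Fin k} (ha : (a : ℕ) + 1 < k) :
    sWord^[n + 1] [a] = sWord^[n] [⟨0, a.pos⟩] ++ sWord^[n] [⟨(a : ℕ) + 1, ha⟩] := by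
  rw [Function.iterate_succ_apply, sWord_singleton, sLetter_of_lt ha, ← sWord_iterate_append]
  rfl

lemma sWord_iterate_succ_of_not_lt (n : ℕ) {a : Fin k} (ha : ¬ (a : ℕ) + 1 < k) :
    sWord^[n + 1] [a] = sWord^[n] [⟨0, a.pos⟩] := by
  rw [Function.iterate_succ_apply, sWord_singleton, sLetter_of_not_lt ha]

lemma length_sWord_iterate_anti (n : ℕ) {a b : Fin k} (hab : a ≤ b) :
    (sWord^[n] [b]).length ≤ (sWord^[n] [a]).length := by
  induction n generalizing a b with
  | zero => simp
  | succ n ih =>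
    have hab' : (a : ℕ) ≤ b := hab
    by_cases hb : (b : ℕ) + 1 < k
    · have ha : (a : ℕ) + 1 < k := by omega
      rw [sWord_iterate_succ_of_lt n hb, sWord_iterate_succ_of_lt n ha, List.length_append,
        List.length_append]
      exact Nat.add_le_add_left (ih (Fin.mk_le_mk.2 (by omega))) _
    · rw [sWord_iterate_succ_of_not_lt n hb]
      by_cases ha : (a : ℕ) + 1 < k
      · rw [sWord_iterate_succ_of_lt n ha, List.length_append]
        exact Nat.le_add_right _ _
      · rw [sWord_iterate_succ_of_not_lt n ha]

lemma length_sWord_iterate_succ_le (n : ℕ) (a : Fin k) :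
    (sWord^[n + 1] [a]).length ≤ 2 * (sWord^[n] [(⟨0, a.pos⟩ : Fin k)]).length := by
  by_cases ha : (a : ℕ) + 1 < k
  · rw [sWord_iterate_succ_of_lt n ha, List.length_append, two_mul]
    exact Nat.add_le_add_left (length_sWord_iterate_anti n (Fin.mk_le_mk.2 (Nat.zero_le _))) _
  · rw [sWord_iterate_succ_of_not_lt n ha]
    omega

lemma lt_length_sWord_iterate_zero (hk : 2 ≤ k) (n : ℕ) :
    n < (sWord^[n] [(⟨0, by omega⟩ : Fin k)]).length := by
  induction n with
  | zero => simp
  | succ n ih =>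
    have h1 : ((⟨0, by omega⟩ : Fin k) : ℕ) + 1 < k := by simp; omega
    rw [sWord_iterate_succ_of_lt n h1, List.length_append]
    exact Nat.add_lt_add_of_lt_of_le ih (length_le_length_sWord_iterate n [_])

end Words

section Language

variable {k : ℕ}

lemma Lang.of_infix {u w : List (Fin k)} (hw : Lang w) (h : u <:+: w) : Lang u := by
  obtain ⟨a, m, hm⟩ := hw
  exact ⟨a, m, h.trans hm⟩

lemma Lang.sWord {w : List (Fin k)} (hw : Lang w) : Lang (sWord w) := by
  obtain ⟨a, m, s, t, hm⟩ := hw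
  refine ⟨a, m + 1, _root_.sWord s, _root_.sWord t, ?_⟩
  rw [← sWord_append, ← sWord_append, hm, Function.iterate_succ_apply']

lemma Lang.sWord_iterate {w : List (Fin k)} (hw : Lang w) (n : ℕ) :
    Lang (_root_.sWord^[n] w) := by
  induction n with
  | zero => exact hw
  | succ n ih =>
    rw [Function.iterate_succ_apply']
    exact ih.sWord

lemma exists_lang_pair (hk : 2 ≤ k) (n : ℕ) (hn : n < k) :
    ∃ c : Fin k, Lang [⟨n, hn⟩, c] := by
  induction n with
  | zero =>
    have h1 : ((⟨0, hn⟩ : Fin k) : ℕ) + 1 < k := by simp; omega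
    refine ⟨⟨_, h1⟩, ⟨0, hn⟩, 1, ?_⟩
    rw [Function.iterate_one, sWord_singleton, sLetter_of_lt h1]
  | succ n ih =>
    obtain ⟨c, hc⟩ := ih (by omega)
    obtain ⟨t, ht⟩ := exists_sLetter_eq_cons c
    refine ⟨⟨0, c.pos⟩, hc.sWord.of_infix ⟨[⟨0, c.pos⟩], t, ?_⟩⟩
    simp [sWord, ht, sLetter_of_lt (a := (⟨n, by omega⟩ : Fin k)) hn]

lemma lang_sLetter_append_zero (hk : 2 ≤ k) (a : Fin k) :
    Lang (sLetter a ++ [⟨0, a.pos⟩]) := by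
  obtain ⟨c, hc⟩ := exists_lang_pair hk a a.isLt
  obtain ⟨t, ht⟩ := exists_sLetter_eq_cons c
  refine hc.sWord.of_infix ⟨[], t, ?_⟩
  simp [sWord, ht]

end Language

section Sequences

variable {k : ℕ}

@[simp] lemma length_pref (x : ℕ → Fin k) (n : ℕ) : (pref x n).length = n := by
  simp [pref]

lemma shift_iterate_apply (i n : ℕ) (x : ℕ → Fin k) : shift^[i] x n = x (i + n) := by
  induction i generalizing x with
  | zero => simp
  | succ i ih =>
    rw [Function.iterate_succ_apply, ih, shift]
    congr 1
    omega

lemma pref_add (x : ℕ → Fin k) (m n : ℕ) :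
    pref x (m + n) = pref x m ++ pref (shift^[m] x) n := by
  simp [pref, List.range_add, shift_iterate_apply, Function.comp_def]

lemma pref_succ (x : ℕ → Fin k) (n : ℕ) : pref x (n + 1) = pref x n ++ [x n] := by
  simp [pref, List.range_succ]

lemma pref_eq_of_prefix {x : ℕ → Fin k} {u : List (Fin k)} {n : ℕ} (h : u <+: pref x n) :
    pref x u.length = u := by
  have hle := h.length_le
  rw [length_pref] at hle
  obtain ⟨d, rfl⟩ := Nat.exists_eq_add_of_le hle
  rw [pref_add] at h
  exact ((List.prefix_of_prefix_length_le h (List.prefix_append _ _) (by simp)).eq_of_length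
    (by simp)).symm

lemma getD_sWord_pref_add (x : ℕ → Fin k) {j m : ℕ} (n : ℕ) (d e : Fin k)
    (hj : j < (sWord (pref x m)).length) :
    (sWord (pref x (m + n))).getD j d = (sWord (pref x m)).getD j e := by
  rw [pref_add, sWord_append, List.getD_append _ _ _ _ hj, List.getD_eq_getElem _ _ hj,
    List.getD_eq_getElem _ _ hj]

lemma sSeq_eq_getD (x : ℕ → Fin k) {j m : ℕ} (d : Fin k)
    (hj : j < (sWord (pref x m)).length) :
    sSeq x j = (sWord (pref x m)).getD j d := by
  have hj' : j < (sWord (pref x (j + 1))).length := by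
    have := length_le_length_sWord (pref x (j + 1))
    rw [length_pref] at this
    omega
  rw [sSeq, ← getD_sWord_pref_add x m d _ hj', ← getD_sWord_pref_add x (j + 1) _ _ hj,
    Nat.add_comm]

lemma pref_sSeq (x : ℕ → Fin k) (m : ℕ) :
    pref (sSeq x) (sWord (pref x m)).length = sWord (pref x m) := by
  refine List.ext_getElem (by simp) fun j h₁ h₂ => ?_
  rw [show (pref (sSeq x) (sWord (pref x m)).length)[j] = sSeq x j by simp [pref],
    sSeq_eq_getD x (x 0) h₂, List.getD_eq_getElem _ _ h₂]

lemma pref_sSeq_iterate (x : ℕ → Fin k) (m n : ℕ) :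
    pref (sSeq^[n] x) (sWord^[n] (pref x m)).length = sWord^[n] (pref x m) := by
  induction n with
  | zero => simp
  | succ n ih =>
    rw [Function.iterate_succ_apply', Function.iterate_succ_apply']
    have := pref_sSeq (sSeq^[n] x) (sWord^[n] (pref x m)).length
    rwa [ih] at this

lemma sSeq_shift_iterate (x : ℕ → Fin k) (i : ℕ) :
    sSeq (shift^[i] x) = shift^[(sWord (pref x i)).length] (sSeq x) := by
  funext j
  have hj : j < (sWord (pref (shift^[i] x) (j + 1))).length := by
    have := length_le_length_sWord (pref (shift^[i] x) (j + 1))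
    rw [length_pref] at this
    omega
  rw [shift_iterate_apply, sSeq_eq_getD x (m := i + (j + 1)) (x 0), sSeq_eq_getD _ (x 0) hj,
    pref_add x, sWord_append, List.getD_append_right _ _ _ _ (Nat.le_add_right _ _),
    Nat.add_sub_cancel_left]
  rw [pref_add x, sWord_append, List.length_append]
  omega

lemma le_delta_of_lang {x : ℕ → Fin k} {n : ℕ} (h : Lang (pref x n)) : (n : ℕ∞) ≤ delta x :=
  le_sSup ⟨n, rfl, h⟩

lemma sum_renorm_shift (V : (ℕ → Fin k) → ℝ) (x : ℕ → Fin k) (m : ℕ) :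
    ∑ i ∈ Finset.range m, Renorm V (shift^[i] x) =
      ∑ j ∈ Finset.range (sWord (pref x m)).length, V (shift^[j] (sSeq x)) := by
  induction m with
  | zero => simp [pref, sWord]
  | succ m ih =>
    rw [Finset.sum_range_succ, ih, pref_succ, sWord_append, List.length_append,
      Finset.sum_range_add, sWord_singleton]
    congr 1
    rw [Renorm, shift_iterate_apply, Nat.add_zero]
    refine Finset.sum_congr rfl fun j _ => ?_
    rw [sSeq_shift_iterate, ← Function.iterate_add_apply, Nat.add_comm]

lemma renorm_iterate_apply (n : ℕ) (V : (ℕ → Fin k) → ℝ) (x : ℕ → Fin k) :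
    (Renorm^[n] V) x =
      ∑ j ∈ Finset.range (sWord^[n] [x 0]).length, V (shift^[j] (sSeq^[n] x)) := by
  induction n generalizing V with
  | zero => simp
  | succ n ih =>
    have h := pref_sSeq_iterate x 1 n
    have h1 : pref x 1 = [x 0] := by simp [pref]
    rw [h1] at h
    rw [Function.iterate_succ_apply, ih, sum_renorm_shift, h, Function.iterate_succ_apply',
      Function.iterate_succ_apply']

lemma le_delta_shift_sSeq_iterate (hk : 2 ≤ k) (x : ℕ → Fin k) (n j : ℕ)
    (hj : j ≤ (sWord^[n + 1] [x 0]).length) :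
    ((sWord^[n] [(⟨0, by omega⟩ : Fin k)]).length : ℕ∞) ≤ delta (shift^[j] (sSeq^[n + 1] x)) := by
  set L := (sWord^[n] [(⟨0, by omega⟩ : Fin k)]).length with hL
  set y := sSeq^[n + 1] x
  set u := sWord^[n] (sLetter (x 0) ++ [(⟨0, by omega⟩ : Fin k)]) with hu
  have hu_length : u.length = (sWord^[n + 1] [x 0]).length + L := by
    rw [hu, sWord_iterate_append, List.length_append, Function.iterate_succ_apply,
      sWord_singleton]
  have hu_lang : Lang u := (lang_sLetter_append_zero hk (x 0)).sWord_iterate n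
  have hu_prefix : u <+: sWord^[n + 1] (pref x 2) := by
    obtain ⟨t, ht⟩ := exists_sLetter_eq_cons (x 1)
    refine ⟨sWord^[n] t, ?_⟩
    rw [hu, ← sWord_iterate_append, Function.iterate_succ_apply]
    congr 1
    simp [pref, sWord, List.range_succ, ht]
  have hy : pref y u.length = u :=
    pref_eq_of_prefix (by rwa [← pref_sSeq_iterate x 2 (n + 1)] at hu_prefix)
  refine le_delta_of_lang (hu_lang.of_infix ?_)
  rw [← hy, hu_length, show (sWord^[n + 1] [x 0]).length + L =
    j + (L + ((sWord^[n + 1] [x 0]).length - j)) by omega, pref_add, pref_add]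
  exact ⟨pref y j, _, List.append_assoc _ _ _⟩

end Sequences

theorem stmt10 (k : ℕ) (hk : 2 ≤ k) (α : ℝ) (hα : 1 < α)
    (g h : (ℕ → Fin k) → ℝ) (hg : Continuous g) (hgpos : ∀ x, 0 < g x)
    (hh : Continuous h) (hh0 : ∀ x ∈ Attr k, h x = 0)
    (V : (ℕ → Fin k) → ℝ)
    (hV : ∀ x, V x = if delta x = ⊤ then 0 else (g x + h x) / ((delta x).toNat : ℝ) ^ α)
    (hVnn : ∀ x, 0 ≤ V x)
    (x : ℕ → Fin k) (hx : x ∉ Attr k) :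
    Filter.Tendsto (fun n => (Renorm^[n] V) x) Filter.atTop (nhds 0) := by
  obtain ⟨C, hC⟩ := isCompact_univ.exists_bound_of_continuousOn (hg.add hh).continuousOn
  have hC0 : 0 ≤ C := (norm_nonneg _).trans (hC x (Set.mem_univ x))
  set L : ℕ → ℕ := fun n => (sWord^[n] [(⟨0, by omega⟩ : Fin k)]).length with hL
  have hL_lt (n : ℕ) : n < L n := lt_length_sWord_iterate_zero hk n
  have hL_tendsto : Filter.Tendsto (fun n => (L n : ℝ)) Filter.atTop Filter.atTop :=
    tendsto_natCast_atTop_atTop.comp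
      (Filter.tendsto_atTop_mono (fun n => (hL_lt n).le) Filter.tendsto_id)
  have hV_le (n j : ℕ) (hj : j ≤ (sWord^[n + 1] [x 0]).length) :
      V (shift^[j] (sSeq^[n + 1] x)) ≤ C / (L n : ℝ) ^ α := by
    have hLpos : (0 : ℝ) < L n := Nat.cast_pos.2 ((Nat.zero_le n).trans_lt (hL_lt n))
    rw [hV]
    split_ifs with htop
    · positivity
    · have hle : (L n : ℝ) ≤ (delta (shift^[j] (sSeq^[n + 1] x))).toNat := by
        have := ENat.toNat_le_toNat (le_delta_shift_sSeq_iterate hk x n j hj) htop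
        exact_mod_cast this
      exact div_le_div₀ hC0 ((le_abs_self _).trans (hC _ (Set.mem_univ _)))
        (by positivity) (Real.rpow_le_rpow hLpos.le hle (by linarith))
  rw [← Filter.tendsto_add_atTop_iff_nat 1]
  have hlim : Filter.Tendsto (fun n => 2 * C * (L n : ℝ) ^ (-(α - 1))) Filter.atTop (nhds 0) := by
    simpa using ((tendsto_rpow_neg_atTop (sub_pos.2 hα)).comp hL_tendsto).const_mul (2 * C)
  refine squeeze_zero (fun n => ?_) (fun n => ?_) hlim
  · rw [renorm_iterate_apply]
    exact Finset.sum_nonneg fun j _ => hVnn _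
  · have hLpos : (0 : ℝ) < L n := Nat.cast_pos.2 ((Nat.zero_le n).trans_lt (hL_lt n))
    have hcard : ((sWord^[n + 1] [x 0]).length : ℝ) ≤ 2 * L n := by
      exact_mod_cast length_sWord_iterate_succ_le n (x 0)
    calc (Renorm^[n + 1] V) x
        ≤ (sWord^[n + 1] [x 0]).length * (C / (L n : ℝ) ^ α) := by
          rw [renorm_iterate_apply]
          simpa using Finset.sum_le_card_nsmul (Finset.range _) _ _
            fun j hj => hV_le n j (Finset.mem_range.1 hj).le
      _ ≤ 2 * L n * (C / (L n : ℝ) ^ α) := by gcongr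
      _ = 2 * C * (L n : ℝ) ^ (-(α - 1)) := by
          rw [neg_sub, Real.rpow_sub hLpos, Real.rpow_one]
          ring
end

section
/- Let k ≥ 2 be an integer and let S be the incidence matrix of s_k, defined by S_{i,j} = |s_k(j)|_i for i, j ∈ A_k. Then the vector v = (v_0,…,v_{k−1}) with v_l = λ^{−(k−1−l)} Σ_{j=0}^{k−1−l} λ^j is a left eigenvector of S for the eigenvalue λ: for every j ∈ A_k, Σ_{i∈A_k} v_i S_{i,j} = λ v_j. Moreover v_0 = λ. -/
theorem vcoef_zero {k : ℕ} (hk : 1 ≤ k) {lam : ℝ} (hlam : lam ≠ 0)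
    (hroot : lam ^ k = ∑ j ∈ Finset.range k, lam ^ j) : vcoef k lam 0 = lam := by
  obtain ⟨m, rfl⟩ := Nat.exists_eq_add_of_le' hk
  simp only [vcoef, Nat.sub_zero, Nat.add_sub_cancel]
  rw [← hroot, pow_succ, mul_div_cancel_left₀ _ (pow_ne_zero m hlam)]

theorem vcoef_pred {k : ℕ} (lam : ℝ) {l : ℕ} (hl : l + 1 = k) : vcoef k lam l = 1 := by
  subst hl
  simp [vcoef]

theorem mul_vcoef {k : ℕ} {lam : ℝ} (hlam : lam ≠ 0) {l : ℕ} (hl : l + 1 < k) :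
    lam * vcoef k lam l = lam + vcoef k lam (l + 1) := by
  obtain ⟨m, rfl⟩ := Nat.exists_eq_add_of_lt hl
  have h₁ : l + 1 + m + 1 - l = m + 2 := by omega
  have h₂ : l + 1 + m + 1 - 1 - l = m + 1 := by omega
  have h₃ : l + 1 + m + 1 - (l + 1) = m + 1 := by omega
  have h₄ : l + 1 + m + 1 - 1 - (l + 1) = m := by omega
  simp only [vcoef, h₁, h₂, h₃, h₄]
  rw [Finset.sum_range_succ _ (m + 1)]
  field_simp
  ring

theorem sum_mul_count_eq_sum_map {ι : Type*} [Fintype ι] [DecidableEq ι] (f : ι → ℝ)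
    (w : List ι) : ∑ i, f i * (w.count i : ℝ) = (w.map f).sum := by
  induction w with
  | nil => simp
  | cons a w ih =>
    simp [List.count_cons, mul_add, Finset.sum_add_distrib, ih, add_comm]

theorem stmt16 (k : ℕ) (hk : 2 ≤ k) (lam : ℝ) (hlam : 1 < lam)
    (hroot : lam ^ k = ∑ j ∈ Finset.range k, lam ^ j) :
    (∀ j : Fin k,
        ∑ i : Fin k, vcoef k lam (i : ℕ) * ((sLetter j).count i : ℝ)
          = lam * vcoef k lam (j : ℕ))
    ∧ vcoef k lam 0 = lam := by
  have hne : lam ≠ 0 := by positivity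
  have h0 := vcoef_zero (by omega) hne hroot
  refine ⟨fun j => ?_, h0⟩
  rw [sum_mul_count_eq_sum_map (fun i : Fin k => vcoef k lam i)]
  by_cases h : (j : ℕ) + 1 < k
  · simp [sLetter, h, h0, mul_vcoef hne h]
  · simp [sLetter, h, h0, vcoef_pred lam (show (j : ℕ) + 1 = k by omega)]
end

section
/- Let s_3 be the Tribonacci substitution. Every word w ∈ L_{s_3} whose first letter is 0 and whose last letter is 1 or 2 has a unique preimage under s_3: there exists exactly one finite word v over {0,1,2} such that s_3(v) = w. -/
theorem sWord_nil {k : ℕ} : sWord ([] : List (Fin k)) = [] := rfl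

theorem sWord_cons {k : ℕ} (a : Fin k) (v : List (Fin k)) :
    sWord (a :: v) = sLetter a ++ sWord v := rfl

theorem sLetter_tribonacci_zero : sLetter (0 : Fin 3) = [0, 1] := rfl

theorem sLetter_tribonacci_one : sLetter (1 : Fin 3) = [0, 2] := rfl

theorem sLetter_tribonacci_two : sLetter (2 : Fin 3) = [0] := rfl

theorem head?_sWord_tribonacci (v : List (Fin 3)) :
    sWord v = [] ∨ (sWord v).head? = some 0 := by
  rcases v with _ | ⟨a, v⟩
  · exact Or.inl rfl
  · right
    fin_cases a <;> rfl

theorem sWord_tribonacci_injective :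
    Function.Injective (sWord : List (Fin 3) → List (Fin 3)) := by
  intro u
  induction u with
  | nil =>
    rintro (_ | ⟨b, v⟩) h
    · rfl
    · fin_cases b <;> simp [sWord_nil, sWord_cons, sLetter_tribonacci_zero,
        sLetter_tribonacci_one, sLetter_tribonacci_two] at h
  | cons a u ih =>
    rintro (_ | ⟨b, v⟩) h
    · fin_cases a <;> simp [sWord_nil, sWord_cons, sLetter_tribonacci_zero,
        sLetter_tribonacci_one, sLetter_tribonacci_two] at h
    · have hu := head?_sWord_tribonacci u
      have hv := head?_sWord_tribonacci v
      fin_cases a <;> fin_cases b <;>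
        simp [sWord_cons, sLetter_tribonacci_zero, sLetter_tribonacci_one,
          sLetter_tribonacci_two] at h ⊢ <;>
        first
        | exact ih h
        | simp [← h] at hv
        | simp [h] at hu

/-- A suffix of an image that starts with `0` is itself an image. -/
theorem exists_sWord_eq_of_suffix {u w : List (Fin 3)} (h : w <:+ sWord u)
    (hw : w.head? = some 0) : ∃ v, sWord v = w := by
  induction u with
  | nil =>
    rw [sWord_nil, List.suffix_nil] at h
    simp [h] at hw
  | cons a u ih =>
    by_cases hs : w = sWord (a :: u)
    · exact ⟨_, hs.symm⟩
    · refine ih ?_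
      fin_cases a <;>
        simp [sWord_cons, sLetter_tribonacci_zero, sLetter_tribonacci_one,
          sLetter_tribonacci_two, List.suffix_cons_iff] at h hs ⊢ <;>
        grind

/-- A prefix of an image that does not end with `0` is itself an image. -/
theorem exists_sWord_eq_of_prefix {u w : List (Fin 3)} (h : w <+: sWord u)
    (hw : w.getLast? ≠ some 0) : ∃ v, sWord v = w := by
  induction u generalizing w with
  | nil => exact ⟨[], by rw [sWord_nil, List.prefix_nil] at h; rw [h, sWord_nil]⟩
  | cons a u ih =>
    have step (t : List (Fin 3)) (ht : w = sLetter a ++ t) (hp : t <+: sWord u) :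
        ∃ v, sWord v = w := by
      obtain ⟨v, rfl⟩ := ih hp (by grind)
      exact ⟨a :: v, ht.symm⟩
    by_cases hn : w = []
    · exact ⟨[], hn.symm⟩
    · fin_cases a <;>
        simp [sWord_cons, sLetter_tribonacci_zero, sLetter_tribonacci_one,
          sLetter_tribonacci_two, List.prefix_cons_iff, hn] at h step <;>
        grind

theorem stmt18 (w : List (Fin 3)) (hw : Lang w)
    (hfirst : w.head? = some 0)
    (hlast : w.getLast? = some 1 ∨ w.getLast? = some 2) :
    ∃! v : List (Fin 3), sWord v = w := by
  obtain ⟨a, m, h⟩ := hw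
  have hlast0 : w.getLast? ≠ some 0 := by rcases hlast with h | h <;> simp [h]
  refine existsUnique_of_exists_of_unique ?_ fun v₁ v₂ h₁ h₂ =>
    sWord_tribonacci_injective (h₁.trans h₂.symm)
  cases m with
  | zero =>
    have hlen : w.length ≤ 1 := h.length_le
    rcases w with _ | ⟨b, _ | ⟨c, w⟩⟩
    · simp at hfirst
    · exact absurd hfirst hlast0
    · simp at hlen
  | succ m =>
    rw [Function.iterate_succ_apply'] at h
    obtain ⟨t, ht, hts⟩ := List.infix_iff_prefix_suffix.mp h
    have hthead : t.head? = some 0 := by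
      obtain ⟨q, rfl⟩ := ht
      simp [hfirst]
    obtain ⟨u, rfl⟩ := exists_sWord_eq_of_suffix hts hthead
    exact exists_sWord_eq_of_prefix ht hlast0
end
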